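/- Let σ be the endomorphism of the free group F(x₀, x₁, x₂, x₃) on four generators defined by σ(x₀) = x₀x₁, σ(x₁) = x₀x₂x₃x₁x₃x₂, σ(x₂) = x₀x₂x₃x₂, σ(x₃) = x₀x₁x₃x₁. Then σ is injective. -/

import Mathlib

/-- Abbreviation for the generators of the free group on four letters. -/
def x (i : Fin 4) : FreeGroup (Fin 4) := FreeGroup.of i

/-- Edge labels on the second sheet of the two-sheeted cover. -/
def lab : Fin 4 → FreeGroup (Fin 4) :=
  ![x 0, (x 2)⁻¹ * x 1, (x 0)⁻¹ * x 2, (x 0)⁻¹ * x 3]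

/-- The generators other than `x 2` swap the two sheets. -/
def flips : Fin 4 → Bool := ![true, true, false, true]

/-- The permutation of `F × Bool` attached to a generator. -/
def stepPerm (i : Fin 4) : Equiv.Perm (FreeGroup (Fin 4) × Bool) where
  toFun p := ((bif p.2 then lab i else 1) * p.1, xor p.2 (flips i))
  invFun p := ((bif xor p.2 (flips i) then lab i else 1)⁻¹ * p.1, xor p.2 (flips i))
  left_inv p := by simp
  right_inv p := by simp

/-- The induced action of the free group. -/
def rho : FreeGroup (Fin 4) →* Equiv.Perm (FreeGroup (Fin 4) × Bool) :=
  FreeGroup.lift stepPerm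

theorem rho_x (i : Fin 4) (p : FreeGroup (Fin 4) × Bool) :
    rho (x i) p = ((bif p.2 then lab i else 1) * p.1, xor p.2 (flips i)) := by
  simp [rho, x, stepPerm]

/-- The return substitution `τ_{0,10}` of the Thue–Morse substitution, viewed as an
endomorphism of the free group on four generators, is injective. -/
theorem thue_morse_return_injective (σ : FreeGroup (Fin 4) →* FreeGroup (Fin 4))
    (h0 : σ (x 0) = x 0 * x 1)
    (h1 : σ (x 1) = x 0 * x 2 * x 3 * x 1 * x 3 * x 2)
    (h2 : σ (x 2) = x 0 * x 2 * x 3 * x 2)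
    (h3 : σ (x 3) = x 0 * x 1 * x 3 * x 1) :
    Function.Injective σ := by
  have gen : ∀ (i : Fin 4) (g : FreeGroup (Fin 4)),
      rho (σ (x i)) (g, false) = (x i * g, false) := by
    intro i g
    fin_cases i
    · simp [h0, rho_x, lab, flips, mul_assoc]
    · simp [h1, rho_x, lab, flips, mul_assoc]
    · simp [h2, rho_x, lab, flips, mul_assoc]
    · simp [h3, rho_x, lab, flips, mul_assoc]
  have key : ∀ w g : FreeGroup (Fin 4), rho (σ w) (g, false) = (w * g, false) := by
    intro w
    induction w using FreeGroup.induction_on with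
    | C1 => simp
    | of i => exact gen i
    | inv_of i _ =>
      intro g
      rw [map_inv, map_inv, Equiv.Perm.inv_eq_iff_eq]
      have := gen i ((x i)⁻¹ * g)
      rw [mul_inv_cancel_left] at this
      exact this.symm
    | mul a b ha hb =>
      intro g
      rw [map_mul, map_mul, Equiv.Perm.mul_apply, hb, ha, mul_assoc]
  intro v w hvw
  have h := key v 1
  rw [hvw, key w 1] at h
  simpa using h.symm
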